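/- Under the f-total malicious model with the synchronous DP-MSR algorithm, define for k ≥ 1 the quantities x̄[k] = max over normal agents i of max(x̂_i[k], x̂_i[k−1]) and x_[k] = min over normal agents i of min(x̂_i[k], x̂_i[k−1]). Then x̄[k] is nonincreasing in k and x_[k] is nondecreasing in k, regardless of the malicious agents' inputs. -/

import Mathlib

open Finset Filter

/-- In-neighbor set of node `i`: `(j, i) ∈ E` means `i` receives information from `j`. -/
def inNbr {n : ℕ} (E : Finset (Fin n × Fin n)) (i : Fin n) : Finset (Fin n) :=
  Finset.univ.filter fun j => (j, i) ∈ E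

/-- `XSet E r S`: nodes of `S` with at least `r` in-neighbors outside `S`. -/
def XSet {n : ℕ} (E : Finset (Fin n × Fin n)) (r : ℕ) (S : Finset (Fin n)) :
    Finset (Fin n) :=
  S.filter fun i => r ≤ ((inNbr E i) \ S).card

/-- `(r,s)`-robustness of the digraph with edge set `E`. -/
def IsRSRobust {n : ℕ} (E : Finset (Fin n × Fin n)) (r s : ℕ) : Prop :=
  ∀ S1 S2 : Finset (Fin n), S1.Nonempty → S2.Nonempty → Disjoint S1 S2 →
    XSet E r S1 = S1 ∨ XSet E r S2 = S2 ∨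
      s ≤ (XSet E r S1).card + (XSet E r S2).card

/-- DP-MSR filtered weights: given the relative values `rel j` of the neighbors of
agent `i`, the weight function `a` is admissible if, after ignoring (setting weight 0)
the `f` neighbors with largest relative values when at least `f` of them are `≥ 0`
(all neighbors with values `≥ 0` otherwise), and similarly the `f` neighbors with
smallest relative values when at least `f` of them are `≤ 0` (all with values `≤ 0`
otherwise), the weights of the remaining neighbors lie in `[γ,1)`, non-neighbors get
weight 0, and the weights sum to at most 1. -/
def MSRWeights {n : ℕ} (E : Finset (Fin n × Fin n)) (f : ℕ) (γ : ℝ)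
    (i : Fin n) (rel : Fin n → ℝ) (a : Fin n → ℝ) : Prop :=
  ∃ Fup Fdn : Finset (Fin n), Fup ⊆ inNbr E i ∧ Fdn ⊆ inNbr E i ∧
    (if f ≤ ((inNbr E i).filter fun j => 0 ≤ rel j).card
      then Fup.card = f ∧ ∀ j ∈ Fup, ∀ j' ∈ inNbr E i \ Fup, rel j' ≤ rel j
      else Fup = (inNbr E i).filter fun j => 0 ≤ rel j) ∧
    (if f ≤ ((inNbr E i).filter fun j => rel j ≤ 0).card
      then Fdn.card = f ∧ ∀ j ∈ Fdn, ∀ j' ∈ inNbr E i \ Fdn, rel j ≤ rel j'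
      else Fdn = (inNbr E i).filter fun j => rel j ≤ 0) ∧
    (∀ j, j ∉ inNbr E i → a j = 0) ∧
    (∀ j ∈ Fup ∪ Fdn, a j = 0) ∧
    (∀ j ∈ (inNbr E i) \ (Fup ∪ Fdn), γ ≤ a j ∧ a j < 1) ∧
    (∑ j ∈ inNbr E i, a j) ≤ 1

/-- Sampled-data double-integrator dynamics for all agents. -/
def SyncDynamics {n : ℕ} (T : ℝ) (x v u : ℕ → Fin n → ℝ) : Prop :=
  ∀ k i, x (k + 1) i = x k i + T * v k i + T ^ 2 / 2 * u k i ∧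
         v (k + 1) i = v k i + T * u k i

/-- Every normal agent (not in `M`) applies the synchronous DP-MSR control law. -/
def SyncDPMSR {n : ℕ} (E : Finset (Fin n × Fin n)) (f : ℕ) (γ α : ℝ)
    (M : Finset (Fin n)) (x v u : ℕ → Fin n → ℝ) : Prop :=
  ∀ k, ∀ i ∉ M, ∃ a : Fin n → ℝ,
    MSRWeights E f γ i (fun j => x k j - x k i) a ∧
    u k i = (∑ j ∈ inNbr E i, a j * (x k j - x k i)) - α * v k i

/-- `x̄[k]`: the maximum over normal agents of `max(x̂_i[k], x̂_i[k−1])`. -/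
noncomputable def xbar {n : ℕ} (M : Finset (Fin n)) (x : ℕ → Fin n → ℝ) (k : ℕ) : ℝ :=
  sSup {y : ℝ | ∃ i ∉ M, y = max (x k i) (x (k - 1) i)}

/-- `x_[k]`: the minimum over normal agents of `min(x̂_i[k], x̂_i[k−1])`. -/
noncomputable def xlow {n : ℕ} (M : Finset (Fin n)) (x : ℕ → Fin n → ℝ) (k : ℕ) : ℝ :=
  sInf {y : ℝ | ∃ i ∉ M, y = min (x k i) (x (k - 1) i)}

/-- Negating the relative values exchanges the roles of the two filtered sets. -/
theorem MSRWeights.neg {n : ℕ} {E : Finset (Fin n × Fin n)} {f : ℕ} {γ : ℝ} {i : Fin n}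
    {rel a : Fin n → ℝ} (h : MSRWeights E f γ i rel a) :
    MSRWeights E f γ i (fun j => -rel j) a := by
  obtain ⟨Fup, Fdn, hup, hdn, h1, h2, h3, h4, h5, h6⟩ := h
  refine ⟨Fdn, Fup, hdn, hup, ?_, ?_, h3, ?_, ?_, h6⟩
  · simpa only [Left.nonneg_neg_iff, neg_le_neg_iff] using h2
  · simpa only [Left.neg_nonpos_iff, neg_le_neg_iff] using h1
  · rwa [Finset.union_comm]
  · rwa [Finset.union_comm]

theorem MSRWeights.nonneg {n : ℕ} {E : Finset (Fin n × Fin n)} {f : ℕ} {γ : ℝ} {i : Fin n}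
    {rel a : Fin n → ℝ} (h : MSRWeights E f γ i rel a) (hγ : 0 ≤ γ) (j : Fin n) : 0 ≤ a j := by
  obtain ⟨Fup, Fdn, -, -, -, -, h3, h4, h5, -⟩ := h
  by_cases hj : j ∈ inNbr E i
  · by_cases hF : j ∈ Fup ∪ Fdn
    · exact (h4 j hF).ge
    · exact hγ.trans (h5 j (Finset.mem_sdiff.2 ⟨hj, hF⟩)).1
  · exact (h3 j hj).ge

/-- A neighbor that survives the filter has a relative value not exceeding any nonnegative
upper bound on the relative values of the normal agents. -/
theorem MSRWeights.rel_le {n : ℕ} {E : Finset (Fin n × Fin n)} {f : ℕ} {γ : ℝ} {i : Fin n}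
    {rel a : Fin n → ℝ} (h : MSRWeights E f γ i rel a) {M : Finset (Fin n)} (hM : M.card ≤ f)
    {b : ℝ} (hb : 0 ≤ b) (hrel : ∀ j ∉ M, rel j ≤ b) {j : Fin n} (hj : j ∈ inNbr E i)
    (ha : a j ≠ 0) : rel j ≤ b := by
  obtain ⟨Fup, Fdn, -, -, h1, -, -, h4, -, -⟩ := h
  have hjF : j ∉ Fup := fun hF => ha (h4 j (Finset.mem_union_left _ hF))
  split_ifs at h1 with hc
  · obtain ⟨hcard, hmax⟩ := h1
    by_contra! hlt
    have hsub : insert j Fup ⊆ M := by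
      intro l hl
      by_contra hlM
      have hlb := hrel l hlM
      rcases Finset.mem_insert.1 hl with rfl | hl
      · linarith
      · linarith [hmax l hl j (Finset.mem_sdiff.2 ⟨hj, hjF⟩)]
    have hle := Finset.card_le_card hsub
    rw [Finset.card_insert_of_notMem hjF] at hle
    omega
  · subst h1
    by_contra! hlt
    exact hjF (Finset.mem_filter.2 ⟨hj, hb.trans hlt.le⟩)

theorem MSRWeights.sum_le {n : ℕ} {E : Finset (Fin n × Fin n)} {f : ℕ} {γ : ℝ} {i : Fin n}
    {rel a : Fin n → ℝ} (h : MSRWeights E f γ i rel a) (hγ : 0 ≤ γ) {M : Finset (Fin n)}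
    (hM : M.card ≤ f) {b : ℝ} (hb : 0 ≤ b) (hrel : ∀ j ∉ M, rel j ≤ b) :
    ∑ j ∈ inNbr E i, a j * rel j ≤ b := by
  have hsum : ∑ j ∈ inNbr E i, a j ≤ 1 := by
    obtain ⟨_, _, _, _, _, _, _, _, _, h6⟩ := h
    exact h6
  calc ∑ j ∈ inNbr E i, a j * rel j ≤ ∑ j ∈ inNbr E i, a j * b := by
        refine Finset.sum_le_sum fun j hj => ?_
        by_cases ha : a j = 0
        · simp [ha]
        · exact mul_le_mul_of_nonneg_left (h.rel_le hM hb hrel hj ha) (h.nonneg hγ j)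
    _ = (∑ j ∈ inNbr E i, a j) * b := (Finset.sum_mul _ _ _).symm
    _ ≤ b := mul_le_of_le_one_left hb hsum

theorem SyncDynamics.neg {n : ℕ} {T : ℝ} {x v u : ℕ → Fin n → ℝ} (h : SyncDynamics T x v u) :
    SyncDynamics T (-x) (-v) (-u) := by
  intro k i
  obtain ⟨h1, h2⟩ := h k i
  simp only [Pi.neg_apply, h1, h2]
  constructor <;> ring

theorem SyncDPMSR.neg {n : ℕ} {E : Finset (Fin n × Fin n)} {f : ℕ} {γ α : ℝ}
    {M : Finset (Fin n)} {x v u : ℕ → Fin n → ℝ} (h : SyncDPMSR E f γ α M x v u) :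
    SyncDPMSR E f γ α M (-x) (-v) (-u) := by
  intro k i hi
  obtain ⟨a, ha, hu⟩ := h k i hi
  have hrel : ∀ j, (-x) k j - (-x) k i = -(x k j - x k i) := fun j => by
    simp only [Pi.neg_apply]; ring
  refine ⟨a, ?_, ?_⟩
  · simpa only [hrel] using ha.neg
  · simp only [hrel, mul_neg, Finset.sum_neg_distrib]
    simp only [Pi.neg_apply, hu]
    ring

/-- The control law at a normal agent is a damping term plus a coupling term that is bounded
by the gap between the agent's position and any upper bound on the normal positions. -/
theorem SyncDPMSR.exists_coupling_le {n : ℕ} {E : Finset (Fin n × Fin n)} {f : ℕ} {γ α : ℝ}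
    {M : Finset (Fin n)} {x v u : ℕ → Fin n → ℝ} (h : SyncDPMSR E f γ α M x v u)
    (hγ : 0 ≤ γ) (hM : M.card ≤ f) {B : ℝ} {k : ℕ} (hB : ∀ j ∉ M, x k j ≤ B)
    {i : Fin n} (hi : i ∉ M) : ∃ s ≤ B - x k i, u k i = s - α * v k i := by
  obtain ⟨a, ha, hu⟩ := h k i hi
  exact ⟨_, ha.sum_le hγ hM (sub_nonneg.2 (hB i hi)) fun j hj => sub_le_sub_right (hB j hj) _, hu⟩

/-- An upper bound on the normal positions at two consecutive times persists at the next one. -/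
theorem normal_le_of_le {n : ℕ} {E : Finset (Fin n × Fin n)} {f : ℕ} {T α γ : ℝ}
    (hγ : 0 ≤ γ) (hαT1 : 1 + T ^ 2 / 2 ≤ α * T) (hαT2 : α * T ≤ 2 - T ^ 2 / 2)
    {M : Finset (Fin n)} (hM : M.card ≤ f) {x v u : ℕ → Fin n → ℝ}
    (hdyn : SyncDynamics T x v u) (hmsr : SyncDPMSR E f γ α M x v u) {B : ℝ} {k : ℕ}
    (hB : ∀ j ∉ M, x k j ≤ B) (hB' : ∀ j ∉ M, x (k + 1) j ≤ B) {i : Fin n} (hi : i ∉ M) :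
    x (k + 2) i ≤ B := by
  obtain ⟨s, hs, hu⟩ := hmsr.exists_coupling_le hγ hM hB hi
  obtain ⟨s', hs', hu'⟩ := hmsr.exists_coupling_le hγ hM hB' hi
  obtain ⟨hx, hv⟩ := hdyn k i
  have hx' := (hdyn (k + 1) i).1
  have key : x (k + 2) i = (2 - α * T) * x (k + 1) i + (α * T - 1) * x k i
      + T ^ 2 / 2 * (s + s') := by
    rw [hx', hu', hv, hx, hu]
    ring
  have hT2 : 0 ≤ T ^ 2 / 2 := by positivity
  have e1 := mul_le_mul_of_nonneg_left hs hT2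
  have e2 := mul_le_mul_of_nonneg_left hs' hT2
  have e3 := mul_nonneg (sub_nonneg.2 hαT1) (sub_nonneg.2 (hB i hi))
  have e4 := mul_nonneg (sub_nonneg.2 hαT2) (sub_nonneg.2 (hB' i hi))
  linarith

theorem le_xbar {n : ℕ} (M : Finset (Fin n)) (x : ℕ → Fin n → ℝ) (k : ℕ) {i : Fin n}
    (hi : i ∉ M) : max (x k i) (x (k - 1) i) ≤ xbar M x k := by
  refine le_csSup (Set.Finite.bddAbove ?_) ⟨i, hi, rfl⟩
  refine (Set.finite_range fun i => max (x k i) (x (k - 1) i)).subset ?_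
  rintro y ⟨j, -, rfl⟩
  exact ⟨j, rfl⟩

theorem xlow_eq_neg_xbar_neg {n : ℕ} (M : Finset (Fin n)) (x : ℕ → Fin n → ℝ) (k : ℕ) :
    xlow M x k = -xbar M (-x) k := by
  rw [xlow, xbar, Real.sInf_def]
  congr 2
  ext y
  simp only [Set.mem_neg, Set.mem_ofPred_eq, Pi.neg_apply, max_neg_neg, neg_eq_iff_eq_neg]

theorem xbar_succ_le {n : ℕ} {E : Finset (Fin n × Fin n)} {f : ℕ} {T α γ : ℝ}
    (hγ : 0 ≤ γ) (hαT1 : 1 + T ^ 2 / 2 ≤ α * T) (hαT2 : α * T ≤ 2 - T ^ 2 / 2)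
    {M : Finset (Fin n)} (hM : M.card ≤ f) (hNormal : ∃ i, i ∉ M) {x v u : ℕ → Fin n → ℝ}
    (hdyn : SyncDynamics T x v u) (hmsr : SyncDPMSR E f γ α M x v u) {k : ℕ} (hk : 1 ≤ k) :
    xbar M x (k + 1) ≤ xbar M x k := by
  obtain ⟨m, rfl⟩ := Nat.exists_eq_add_of_le' hk
  have hB : ∀ j ∉ M, x (m + 1) j ≤ xbar M x (m + 1) := fun j hj =>
    (le_max_left _ _).trans (le_xbar M x (m + 1) hj)
  have hB' : ∀ j ∉ M, x m j ≤ xbar M x (m + 1) := fun j hj =>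
    (le_max_right _ _).trans (le_xbar M x (m + 1) hj)
  obtain ⟨i₀, hi₀⟩ := hNormal
  refine csSup_le ⟨_, i₀, hi₀, rfl⟩ ?_
  rintro y ⟨i, hi, rfl⟩
  exact max_le (normal_le_of_le hγ hαT1 hαT2 hM hdyn hmsr hB' hB hi) (hB i hi)

/-- monotonicity, synchronous: under the `f`-total malicious model with
the synchronous DP-MSR algorithm, for `k ≥ 1` the quantity `x̄[k]` is nonincreasing and
`x_[k]` is nondecreasing in `k`, regardless of the malicious agents' inputs. -/
theorem dpmsr_monotone_bounds {n : ℕ} (hn : 1 < n) (E : Finset (Fin n × Fin n))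
    (f : ℕ) (T α γ : ℝ) (hT : 0 < T) (hγ : 0 < γ)
    (hαT1 : 1 + T ^ 2 / 2 ≤ α * T) (hαT2 : α * T ≤ 2 - T ^ 2 / 2)
    (M : Finset (Fin n)) (hM : M.card ≤ f) (hNormal : ∃ i, i ∉ M)
    (x v u : ℕ → Fin n → ℝ)
    (hdyn : SyncDynamics T x v u)
    (hmsr : SyncDPMSR E f γ α M x v u) :
    ∀ k, 1 ≤ k → xbar M x (k + 1) ≤ xbar M x k ∧ xlow M x k ≤ xlow M x (k + 1) := by
  intro k hk
  refine ⟨xbar_succ_le hγ.le hαT1 hαT2 hM hNormal hdyn hmsr hk, ?_⟩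
  rw [xlow_eq_neg_xbar_neg, xlow_eq_neg_xbar_neg]
  exact neg_le_neg (xbar_succ_le hγ.le hαT1 hαT2 hM hNormal hdyn.neg hmsr.neg hk)
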